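/- arXiv:2408.00929 — 5 statements merged into one kernel-verified Lean document; each statement's English description precedes it below -/
import Mathlib

section
/- Let E be a real inner product space and let f : E → ℝ be differentiable everywhere with gradient ∇f that is L-Lipschitz (L > 0), and suppose ‖∇f(w)‖ ≤ G for all w ∈ E. Let γ satisfy 0 ≤ γ ≤ 1/L, let w ∈ E, and let b ∈ E with ‖b‖ ≤ B. Then f(w − γ·(∇f(w) + b)) ≤ f(w) − γ·‖∇f(w)‖² + γ·(1 − γ·L)·G·B + (γ²·L/2)·(G² + B²). -/
/-- The quadratic upper bound for a function with Lipschitz gradient. -/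
theorem le_add_inner_gradient_add_of_lipschitz_gradient
    {E : Type*} [NormedAddCommGroup E] [InnerProductSpace ℝ E] [CompleteSpace E]
    {f : E → ℝ} {L : ℝ} (hdiff : ∀ x : E, DifferentiableAt ℝ f x)
    (hlip : ∀ x y : E, ‖gradient f x - gradient f y‖ ≤ L * ‖x - y‖) (x v : E) :
    f (x + v) ≤ f x + inner ℝ (gradient f x) v + L / 2 * ‖v‖ ^ 2 := by
  have hderiv (t : ℝ) : HasDerivAt
      (fun s : ℝ ↦ f (x + s • v) - s * inner ℝ (gradient f x) v - L / 2 * ‖v‖ ^ 2 * s ^ 2)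
      (inner ℝ (gradient f (x + t • v)) v - inner ℝ (gradient f x) v - L * ‖v‖ ^ 2 * t) t := by
    have hline : HasDerivAt (fun s : ℝ ↦ x + s • v) v t := by
      simpa using ((hasDerivAt_id t).smul_const v).const_add x
    have hf : HasDerivAt (fun s : ℝ ↦ f (x + s • v)) (inner ℝ (gradient f (x + t • v)) v) t := by
      simpa [Function.comp_def] using
        (hdiff (x + t • v)).hasGradientAt.hasFDerivAt.comp_hasDerivAt t hline
    refine ((hf.sub ((hasDerivAt_id t).mul_const (inner ℝ (gradient f x) v))).sub
      ((hasDerivAt_pow 2 t).const_mul (L / 2 * ‖v‖ ^ 2))).congr_deriv ?_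
    push_cast
    ring
  have hanti := antitoneOn_of_deriv_nonpos (convex_Icc (0 : ℝ) 1)
    (fun t _ ↦ (hderiv t).continuousAt.continuousWithinAt)
    (fun t _ ↦ (hderiv t).differentiableAt.differentiableWithinAt) fun t ht ↦ by
      rw [interior_Icc] at ht
      rw [(hderiv t).deriv, ← inner_sub_left, sub_nonpos]
      calc inner ℝ (gradient f (x + t • v) - gradient f x) v
          ≤ ‖gradient f (x + t • v) - gradient f x‖ * ‖v‖ := real_inner_le_norm _ _
        _ ≤ L * ‖x + t • v - x‖ * ‖v‖ := by gcongr; exact hlip _ _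
        _ = L * ‖v‖ ^ 2 * t := by
          rw [add_sub_cancel_left, norm_smul, Real.norm_of_nonneg ht.1.le]
          ring
  have h := hanti (Set.left_mem_Icc.2 zero_le_one) (Set.right_mem_Icc.2 zero_le_one) zero_le_one
  simp only [one_smul, zero_smul, add_zero] at h
  linarith

/-- Descent lemma for one biased gradient-descent step: if `f` has `L`-Lipschitz
gradient bounded by `G`, `0 ≤ γ ≤ 1/L`, and the bias `b` satisfies `‖b‖ ≤ B`, then
`f (w − γ(∇f(w) + b)) ≤ f w − γ‖∇f(w)‖² + γ(1 − γL)GB + (γ²L/2)(G² + B²)`. -/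
theorem biased_gradient_step_descent
    {E : Type*} [NormedAddCommGroup E] [InnerProductSpace ℝ E] [CompleteSpace E]
    (f : E → ℝ) (L G B γ : ℝ) (hL : 0 < L)
    (hdiff : ∀ w : E, DifferentiableAt ℝ f w)
    (hlip : ∀ x y : E, ‖gradient f x - gradient f y‖ ≤ L * ‖x - y‖)
    (hG : ∀ w : E, ‖gradient f w‖ ≤ G)
    (hγ0 : 0 ≤ γ) (hγ1 : γ ≤ 1 / L)
    (w b : E) (hB : ‖b‖ ≤ B) :
    f (w - γ • (gradient f w + b)) ≤
      f w - γ * ‖gradient f w‖ ^ 2 + γ * (1 - γ * L) * G * B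
        + (γ ^ 2 * L / 2) * (G ^ 2 + B ^ 2) := by
  have hstep := le_add_inner_gradient_add_of_lipschitz_gradient hdiff hlip w
    (-(γ • (gradient f w + b)))
  rw [← sub_eq_add_neg, inner_neg_right, real_inner_smul_right, inner_add_right,
    real_inner_self_eq_norm_sq, norm_neg, norm_smul, mul_pow, Real.norm_eq_abs, sq_abs,
    norm_add_sq_real] at hstep
  have hG0 : 0 ≤ G := (norm_nonneg _).trans (hG w)
  have hγL : 0 ≤ 1 - γ * L := sub_nonneg.2 ((le_div_iff₀ hL).1 hγ1)
  have hinner : -inner ℝ (gradient f w) b ≤ G * B :=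
    (neg_le_abs _).trans ((abs_real_inner_le_norm _ _).trans
      (mul_le_mul (hG w) hB (norm_nonneg _) hG0))
  have hcross := mul_le_mul_of_nonneg_left hinner (mul_nonneg hγ0 hγL)
  have hsq : γ ^ 2 * L / 2 * (‖gradient f w‖ ^ 2 + ‖b‖ ^ 2) ≤
      γ ^ 2 * L / 2 * (G ^ 2 + B ^ 2) := by
    gcongr
    exact hG w
  linarith
end

section
/- Let E be a real inner product space and let f : E → ℝ be differentiable everywhere with L-Lipschitz gradient (L > 0) and ‖∇f(w)‖ ≤ G for all w ∈ E. Fix T ≥ 1, 0 < γ ≤ 1/L, a sequence of bias vectors b(0), …, b(T−1) ∈ E with ‖b(t)‖ ≤ B for all t, and a set S ⊆ {0, …, T−1} with |S| ≤ k such that b(t) = 0 for all t ∉ S. Define the trajectory w(t+1) = w(t) − γ·(∇f(w(t)) + b(t)) for 0 ≤ t < T from an arbitrary initial point w(0). Then (1/T)·Σ_{t=0}^{T−1} ‖∇f(w(t))‖² ≤ (f(w(0)) − f(w(T)))/(γ·T) + (γ·L/2)·(G² + (k/T)·B²) + (1 − γ·L)·(k/T)·G·B. -/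
open InnerProductSpace in
/-- The descent lemma: a function with `L`-Lipschitz gradient is bounded above by its quadratic
model. -/
theorem le_add_inner_gradient_add_sq {E : Type*} [NormedAddCommGroup E] [InnerProductSpace ℝ E]
    [CompleteSpace E] {f : E → ℝ} {L : ℝ} (hdiff : ∀ w : E, DifferentiableAt ℝ f w)
    (hlip : ∀ x y : E, ‖gradient f x - gradient f y‖ ≤ L * ‖x - y‖) (x v : E) :
    f (x + v) ≤ f x + inner ℝ (gradient f x) v + L / 2 * ‖v‖ ^ 2 := by
  have hderiv (s : ℝ) : HasDerivAt
      (fun s : ℝ ↦ f (x + s • v) - s * inner ℝ (gradient f x) v - L / 2 * ‖v‖ ^ 2 * s ^ 2)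
      (inner ℝ (gradient f (x + s • v)) v - inner ℝ (gradient f x) v - L * ‖v‖ ^ 2 * s) s := by
    have hline : HasDerivAt (fun s : ℝ ↦ x + s • v) v s := by
      simpa using ((hasDerivAt_id s).smul_const v).const_add x
    have hf := (hdiff (x + s • v)).hasGradientAt.hasFDerivAt.comp_hasDerivAt s hline
    rw [toDual_apply_apply] at hf
    refine ((hf.sub ((hasDerivAt_id s).mul_const _)).sub
      (((hasDerivAt_id s).pow 2).const_mul _)).congr_deriv ?_
    simp only [id]
    push_cast
    ring
  have hanti := antitoneOn_of_deriv_nonpos (convex_Icc (0 : ℝ) 1)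
    (fun s _ ↦ (hderiv s).continuousAt.continuousWithinAt)
    (fun s _ ↦ (hderiv s).differentiableAt.differentiableWithinAt) (fun s hs ↦ by
      rw [interior_Icc] at hs
      rw [(hderiv s).deriv, ← inner_sub_left]
      have hgrad := hlip (x + s • v) x
      rw [add_sub_cancel_left, norm_smul, Real.norm_of_nonneg hs.1.le] at hgrad
      have hinner := real_inner_le_norm (gradient f (x + s • v) - gradient f x) v
      nlinarith [mul_le_mul_of_nonneg_right hgrad (norm_nonneg v)])
  have h := hanti (Set.left_mem_Icc.2 zero_le_one) (Set.right_mem_Icc.2 zero_le_one) zero_le_one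
  simp only [one_smul, zero_smul, add_zero] at h
  linarith

/-- One step of biased gradient descent on a function with `L`-Lipschitz gradient. -/
theorem mul_sq_norm_gradient_le_of_biased_step {E : Type*} [NormedAddCommGroup E]
    [InnerProductSpace ℝ E] [CompleteSpace E] {f : E → ℝ} {L γ : ℝ}
    (hdiff : ∀ w : E, DifferentiableAt ℝ f w)
    (hlip : ∀ x y : E, ‖gradient f x - gradient f y‖ ≤ L * ‖x - y‖)
    (hγ0 : 0 ≤ γ) (hγL : γ * L ≤ 1) (x b : E) :
    γ * ‖gradient f x‖ ^ 2 ≤ f x - f (x - γ • (gradient f x + b))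
      + γ * ((γ * L / 2) * (‖gradient f x‖ ^ 2 + ‖b‖ ^ 2)
        + (1 - γ * L) * (‖gradient f x‖ * ‖b‖)) := by
  have h := le_add_inner_gradient_add_sq hdiff hlip x (-(γ • (gradient f x + b)))
  rw [← sub_eq_add_neg, norm_neg, norm_smul, mul_pow, Real.norm_eq_abs, sq_abs, inner_neg_right,
    inner_smul_right, inner_add_right, real_inner_self_eq_norm_sq, norm_add_sq_real] at h
  have hinner := (abs_le.1 (abs_real_inner_le_norm (gradient f x) b)).1
  nlinarith [mul_le_mul_of_nonneg_left hinner (mul_nonneg hγ0 (sub_nonneg.2 hγL))]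


/-- Convergence of biased gradient descent where at most `k` of the `T` steps carry
a bias of norm at most `B` (Proposition 2 of the paper). -/
theorem biased_sgd_average_gradient_bound
    {E : Type*} [NormedAddCommGroup E] [InnerProductSpace ℝ E] [CompleteSpace E]
    (f : E → ℝ) (L G B γ : ℝ) (T k : ℕ) (hL : 0 < L) (hT : 1 ≤ T)
    (hdiff : ∀ w : E, DifferentiableAt ℝ f w)
    (hlip : ∀ x y : E, ‖gradient f x - gradient f y‖ ≤ L * ‖x - y‖)
    (hG : ∀ w : E, ‖gradient f w‖ ≤ G)
    (hγ0 : 0 < γ) (hγ1 : γ ≤ 1 / L)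
    (b : ℕ → E) (hB : ∀ t < T, ‖b t‖ ≤ B)
    (S : Finset ℕ) (hS : S ⊆ Finset.range T) (hk : S.card ≤ k)
    (hb0 : ∀ t < T, t ∉ S → b t = 0)
    (w : ℕ → E) (hw : ∀ t < T, w (t + 1) = w t - γ • (gradient f (w t) + b t)) :
    (1 / (T : ℝ)) * ∑ t ∈ Finset.range T, ‖gradient f (w t)‖ ^ 2 ≤
      (f (w 0) - f (w T)) / (γ * (T : ℝ))
        + (γ * L / 2) * (G ^ 2 + ((k : ℝ) / (T : ℝ)) * B ^ 2)
        + (1 - γ * L) * ((k : ℝ) / (T : ℝ)) * G * B := by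
  have hT0 : (0 : ℝ) < T := by exact_mod_cast hT
  have hγL : γ * L ≤ 1 := (le_div_iff₀ hL).1 hγ1
  have hγL0 : 0 ≤ γ * L := by positivity
  have hG0 : 0 ≤ G := (norm_nonneg _).trans (hG (w 0))
  have hB0 : 0 ≤ B := (norm_nonneg _).trans (hB 0 hT)
  set C := (γ * L / 2) * B ^ 2 + (1 - γ * L) * (G * B) with hC
  have hC0 : 0 ≤ C :=
    add_nonneg (by positivity) (mul_nonneg (sub_nonneg.2 hγL) (by positivity))
  have hstep : ∀ t ∈ Finset.range T, γ * ‖gradient f (w t)‖ ^ 2 ≤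
      (f (w t) - f (w (t + 1))) + γ * ((γ * L / 2) * G ^ 2 + if t ∈ S then C else 0) := by
    intro t ht
    rw [Finset.mem_range] at ht
    have h := mul_sq_norm_gradient_le_of_biased_step hdiff hlip hγ0.le hγL (w t) (b t)
    rw [← hw t ht] at h
    refine h.trans (add_le_add_right (mul_le_mul_of_nonneg_left ?_ hγ0.le) _)
    have hg2 : ‖gradient f (w t)‖ ^ 2 ≤ G ^ 2 := by gcongr; exact hG _
    split_ifs with hS
    · have hb2 : ‖b t‖ ^ 2 ≤ B ^ 2 := by gcongr; exact hB t ht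
      have hgb : ‖gradient f (w t)‖ * ‖b t‖ ≤ G * B := by
        gcongr
        · exact hG _
        · exact hB t ht
      rw [hC]
      nlinarith [mul_le_mul_of_nonneg_left hg2 hγL0, mul_le_mul_of_nonneg_left hb2 hγL0,
        mul_le_mul_of_nonneg_left hgb (sub_nonneg.2 hγL)]
    · rw [hb0 t ht hS, norm_zero]
      nlinarith [mul_le_mul_of_nonneg_left hg2 hγL0]
  have hsum := Finset.sum_le_sum hstep
  rw [← Finset.mul_sum, Finset.sum_add_distrib, Finset.sum_range_sub', ← Finset.mul_sum,
    Finset.sum_add_distrib, Finset.sum_const, Finset.card_range, Finset.sum_ite_mem,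
    Finset.inter_eq_right.2 hS, Finset.sum_const, nsmul_eq_mul, nsmul_eq_mul] at hsum
  have hkC : (S.card : ℝ) * C ≤ k * C := by gcongr
  have hbound : γ * ∑ t ∈ Finset.range T, ‖gradient f (w t)‖ ^ 2 ≤
      (f (w 0) - f (w T)) + γ * (T * ((γ * L / 2) * G ^ 2) + k * C) :=
    hsum.trans (by gcongr)
  calc (1 / (T : ℝ)) * ∑ t ∈ Finset.range T, ‖gradient f (w t)‖ ^ 2
      = (γ * ∑ t ∈ Finset.range T, ‖gradient f (w t)‖ ^ 2) / (γ * T) := by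
        field_simp
    _ ≤ ((f (w 0) - f (w T)) + γ * (T * ((γ * L / 2) * G ^ 2) + k * C)) / (γ * T) := by
        gcongr
    _ = _ := by
        rw [hC]
        field_simp
        ring
end

section
/- In the forging setting, assume γ ≥ 0 and γ_r ≥ 0. Then for every t ∈ {1, …, T}, the deviation p(t) := w_r(t) − w(t) satisfies ‖p(t)‖ ≤ max{γ_r·G, γ·C}; moreover ‖p(0)‖ = 0. -/
/-- In the forging setting, the deviation `p(t) = w_r(t) − w(t)` between the forged
and original trajectories satisfies `‖p(t)‖ ≤ max (γ_r G) (γ C)` for `1 ≤ t ≤ T`,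
and `‖p(0)‖ = 0`. -/
theorem forging_deviation_bound
    {E : Type*} [NormedAddCommGroup E] [NormedSpace ℝ E]
    (T : ℕ) (L C G γ γr : ℝ) (hL : 0 < L) (hC : 0 < C) (hG : 0 < G)
    (hγ : 0 ≤ γ) (hγr : 0 ≤ γr)
    (F F' H : ℕ → E → E) (In : Set ℕ)
    (hFlip : ∀ t ∈ Set.Icc 1 T, ∀ x y : E, ‖F t x - F t y‖ ≤ L * ‖x - y‖)
    (hF'lip : ∀ t ∈ Set.Icc 1 T, ∀ x y : E, ‖F' t x - F' t y‖ ≤ L * ‖x - y‖)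
    (hbias : ∀ t ∈ Set.Icc 1 T, ∀ w : E, ‖F' t w - F t w‖ ≤ C)
    (hH : ∀ t ∈ Set.Icc 1 T, ∀ w : E, ‖H t w‖ ≤ G)
    (hFeq : ∀ t ∈ Set.Icc 1 T, t ∉ In → F' t = F t)
    (w wr : ℕ → E)
    (hw : ∀ t ∈ Set.Icc 1 T, w t = w (t - 1) - γ • F t (w (t - 1)))
    (hwr0 : wr 0 = w 0)
    (hwrE : ∀ t ∈ Set.Icc 1 T, t ∉ In → wr t = w t - γr • H t (w t))
    (hwrN : ∀ t ∈ Set.Icc 1 T, t ∈ In → wr t = w (t - 1) - γ • F' t (w (t - 1))) :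
    (∀ t ∈ Set.Icc 1 T, ‖wr t - w t‖ ≤ max (γr * G) (γ * C)) ∧ ‖wr 0 - w 0‖ = 0 := by
  refine ⟨fun t ht => ?_, by simp [hwr0]⟩
  by_cases hIn : t ∈ In
  · have hdev : wr t - w t = -(γ • (F' t (w (t - 1)) - F t (w (t - 1)))) := by
      rw [hwrN t ht hIn, hw t ht, smul_sub]
      abel
    rw [hdev, norm_neg, norm_smul, Real.norm_of_nonneg hγ]
    exact (mul_le_mul_of_nonneg_left (hbias t ht _) hγ).trans (le_max_right _ _)
  · have hdev : wr t - w t = -(γr • H t (w t)) := by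
      rw [hwrE t ht hIn]
      abel
    rw [hdev, norm_neg, norm_smul, Real.norm_of_nonneg hγr]
    exact (mul_le_mul_of_nonneg_left (hH t ht _) hγr).trans (le_max_left _ _)
end

section
/- In the forging setting, suppose 0 ≤ γ ≤ (1/(2L))·(√(9 + 4·ε·L/C) − 3) and 0 ≤ γ_r ≤ (ε − γ·C)/(G·(2 + γ·L)), where ε ≥ 0. Then for every t ∈ {1, …, T}, the verification error of the forged trajectory satisfies ‖w_r(t) − (w_r(t−1) − γ·F'_t(w_r(t−1)))‖ ≤ ε; that is, the forging-based adversarial unlearning algorithm produces a reproducible Proof of Retraining under threshold ε. -/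
/-- One gradient step from `y` differs from a perturbed gradient step from `x` by at most
`(1 + γ L) ‖x - y‖` plus the size of the perturbation. -/
theorem norm_perturbed_step_sub_step_le
    {E : Type*} [NormedAddCommGroup E] [NormedSpace ℝ E] {L γ : ℝ} (hγ : 0 ≤ γ) {f : E → E}
    (hf : ∀ x y : E, ‖f x - f y‖ ≤ L * ‖x - y‖) (x y v : E) :
    ‖(x - γ • f x - v) - (y - γ • f y)‖ ≤ (1 + γ * L) * ‖x - y‖ + ‖v‖ := by
  have h : (x - γ • f x - v) - (y - γ • f y) = (x - y) - γ • (f x - f y) - v := by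
    rw [smul_sub]; abel
  calc ‖(x - γ • f x - v) - (y - γ • f y)‖
      ≤ ‖x - y‖ + ‖γ • (f x - f y)‖ + ‖v‖ := by
        rw [h]
        exact (norm_sub_le _ _).trans (add_le_add_left (norm_sub_le _ _) _)
    _ = ‖x - y‖ + γ * ‖f x - f y‖ + ‖v‖ := by rw [norm_smul, Real.norm_of_nonneg hγ]
    _ ≤ ‖x - y‖ + γ * (L * ‖x - y‖) + ‖v‖ := by gcongr; exact hf x y
    _ = (1 + γ * L) * ‖x - y‖ + ‖v‖ := by ring

/-- The step-size bound in closed form implies the quadratic inequality it solves. -/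
theorem mul_three_add_le_of_le_sqrt {L C γ ε : ℝ} (hL : 0 < L) (hC : 0 < C) (hε : 0 ≤ ε)
    (hγ0 : 0 ≤ γ) (hγ1 : γ ≤ (1 / (2 * L)) * (Real.sqrt (9 + 4 * ε * L / C) - 3)) :
    γ * C * (3 + γ * L) ≤ ε := by
  have h1 : 2 * L * γ + 3 ≤ Real.sqrt (9 + 4 * ε * L / C) := by
    rw [one_div_mul_eq_div, le_div_iff₀ (by positivity)] at hγ1
    linarith
  have h2 : (2 * L * γ + 3) ^ 2 ≤ 9 + 4 * ε * L / C :=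
    (Real.le_sqrt (by positivity) (by positivity)).1 h1
  have h3 : (2 * L * γ + 3) ^ 2 - 9 ≤ 4 * ε * L / C := by linarith
  rw [le_div_iff₀ hC] at h3
  refine le_of_mul_le_mul_left ?_ (by positivity : 0 < 4 * L)
  linarith

/-- Proposition 3 of the paper: in the forging setting, if
`0 ≤ γ ≤ (1/(2L))(√(9 + 4εL/C) − 3)` and `0 ≤ γ_r ≤ (ε − γC)/(G(2 + γL))`, then
every verification error of the forged trajectory is at most `ε`, i.e. the
forging-based adversarial unlearning algorithm produces a reproducible Proof of
Retraining under threshold `ε`. -/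
theorem forging_valid_PoRT
    {E : Type*} [NormedAddCommGroup E] [NormedSpace ℝ E]
    (T : ℕ) (L C G γ γr ε : ℝ) (hL : 0 < L) (hC : 0 < C) (hG : 0 < G) (hε : 0 ≤ ε)
    (hγ0 : 0 ≤ γ) (hγ1 : γ ≤ (1 / (2 * L)) * (Real.sqrt (9 + 4 * ε * L / C) - 3))
    (hγr0 : 0 ≤ γr) (hγr1 : γr ≤ (ε - γ * C) / (G * (2 + γ * L)))
    (F F' H : ℕ → E → E) (In : Set ℕ)
    (hFlip : ∀ t ∈ Set.Icc 1 T, ∀ x y : E, ‖F t x - F t y‖ ≤ L * ‖x - y‖)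
    (hF'lip : ∀ t ∈ Set.Icc 1 T, ∀ x y : E, ‖F' t x - F' t y‖ ≤ L * ‖x - y‖)
    (hbias : ∀ t ∈ Set.Icc 1 T, ∀ w : E, ‖F' t w - F t w‖ ≤ C)
    (hH : ∀ t ∈ Set.Icc 1 T, ∀ w : E, ‖H t w‖ ≤ G)
    (hFeq : ∀ t ∈ Set.Icc 1 T, t ∉ In → F' t = F t)
    (w wr : ℕ → E)
    (hw : ∀ t ∈ Set.Icc 1 T, w t = w (t - 1) - γ • F t (w (t - 1)))
    (hwr0 : wr 0 = w 0)
    (hwrE : ∀ t ∈ Set.Icc 1 T, t ∉ In → wr t = w t - γr • H t (w t))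
    (hwrN : ∀ t ∈ Set.Icc 1 T, t ∈ In → wr t = w (t - 1) - γ • F' t (w (t - 1))) :
    ∀ t ∈ Set.Icc 1 T, ‖wr t - (wr (t - 1) - γ • F' t (wr (t - 1)))‖ ≤ ε := by
  have hquad := mul_three_add_le_of_le_sqrt hL hC hε hγ0 hγ1
  have hγL : 0 ≤ γ * L := by positivity
  have hγC : 0 ≤ γ * C := by positivity
  have hγrG : 0 ≤ γr * G := by positivity
  have hlin : γr * G * (2 + γ * L) ≤ ε - γ * C := by
    rw [le_div_iff₀ (by positivity)] at hγr1
    linarith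
  have hnorm : ∀ t ∈ Set.Icc 1 T, ‖γr • H t (w t)‖ ≤ γr * G := fun t ht => by
    rw [norm_smul, Real.norm_of_nonneg hγr0]
    exact mul_le_mul_of_nonneg_left (hH t ht _) hγr0
  have hdist : ∀ t ≤ T, ‖w t - wr t‖ ≤ max (γ * C) (γr * G) := by
    intro t htT
    rcases Nat.eq_zero_or_pos t with rfl | hpos
    · simp [hwr0, hγC]
    have ht : t ∈ Set.Icc 1 T := ⟨hpos, htT⟩
    by_cases hI : t ∈ In
    · refine le_max_of_le_left ?_
      have h : w t - wr t = γ • (F' t (w (t - 1)) - F t (w (t - 1))) := by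
        rw [hwrN t ht hI, hw t ht, smul_sub]; abel
      rw [h, norm_smul, Real.norm_of_nonneg hγ0]
      exact mul_le_mul_of_nonneg_left (hbias t ht _) hγ0
    · refine le_max_of_le_right ?_
      rw [hwrE t ht hI, sub_sub_cancel]
      exact hnorm t ht
  intro t ht
  obtain ⟨v, hv, hwrt⟩ : ∃ v : E, ‖v‖ ≤ γr * G ∧
      wr t = w (t - 1) - γ • F' t (w (t - 1)) - v := by
    by_cases hI : t ∈ In
    · exact ⟨0, by simpa using hγrG, by rw [sub_zero, hwrN t ht hI]⟩
    · exact ⟨γr • H t (w t), hnorm t ht, by rw [hFeq t ht hI, ← hw t ht, hwrE t ht hI]⟩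
  have hstep := norm_perturbed_step_sub_step_le hγ0 (hF'lip t ht) (w (t - 1)) (wr (t - 1)) v
  rw [← hwrt] at hstep
  have hprev := mul_le_mul_of_nonneg_left
    (hdist (t - 1) ((Nat.sub_le t 1).trans ht.2)) (by positivity : 0 ≤ 1 + γ * L)
  refine hstep.trans ((add_le_add hprev hv).trans ?_)
  rcases max_choice (γ * C) (γr * G) with h | h <;> rw [h]
  · have : γr * G ≤ γ * C := h ▸ le_max_right _ _
    linarith
  · linarith
end

section
/- Let L > 0, C > 0, G > 0, ε ≥ 0, γ ≥ 0, and set C' = max{C, G}. If L·C'·γ² + 3·C'·γ ≤ ε, then both γ ≤ (1/(2L))·(√(9 + 4·ε·L/C) − 3) and γ·G·(2 + γ·L) ≤ ε − γ·C. Consequently, choosing the forging learning rate γ_r equal to the training learning rate γ satisfies both hypotheses of the forging validity result (Proposition 3). -/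
/-- Corollary of Proposition 3 for `γ_r = γ`: with `C' = max C G`, if
`L C' γ² + 3 C' γ ≤ ε` then `γ` satisfies both learning-rate hypotheses of the
forging validity result. -/
theorem forging_equal_learning_rates
    (L C G ε γ : ℝ) (hL : 0 < L) (hC : 0 < C) (hG : 0 < G) (hε : 0 ≤ ε) (hγ : 0 ≤ γ)
    (h : L * max C G * γ ^ 2 + 3 * max C G * γ ≤ ε) :
    γ ≤ (1 / (2 * L)) * (Real.sqrt (9 + 4 * ε * L / C) - 3) ∧
      γ * G * (2 + γ * L) ≤ ε - γ * C := by
  have hCM : C ≤ max C G := le_max_left C G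
  have hGM : G ≤ max C G := le_max_right C G
  have hq : 0 ≤ L * γ ^ 2 := by positivity
  constructor
  · have hCε : (L * γ ^ 2 + 3 * γ) * C ≤ ε := by
      have := mul_le_mul_of_nonneg_left hCM (by positivity : 0 ≤ L * γ ^ 2 + 3 * γ)
      linarith
    have hdiv : L * γ ^ 2 + 3 * γ ≤ ε / C := (le_div_iff₀ hC).2 hCε
    have hsqrt : 2 * L * γ + 3 ≤ Real.sqrt (9 + 4 * ε * L / C) := by
      apply Real.le_sqrt_of_sq_le
      have := mul_le_mul_of_nonneg_left hdiv (by positivity : 0 ≤ 4 * L)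
      calc (2 * L * γ + 3) ^ 2 = 9 + 4 * L * (L * γ ^ 2 + 3 * γ) := by ring
        _ ≤ 9 + 4 * L * (ε / C) := by linarith
        _ = 9 + 4 * ε * L / C := by ring
    rw [one_div_mul_eq_div, le_div_iff₀ (by positivity)]
    linarith
  · have hγC := mul_le_mul_of_nonneg_left hCM hγ
    have hγG := mul_le_mul_of_nonneg_left hGM hγ
    have hqG := mul_le_mul_of_nonneg_left hGM hq
    linarith
end
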